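/- Define F₅^{a,b} = F̃(a/5, b/5) − F̃((5−a)/5, (5−b)/5) for integers 1 ≤ a, b ≤ 4. Then (sin(4π/5)/sin(2π/5))·F₅^{1,1}·F₅^{1,2} + (sin(2π/5)/sin(4π/5))·F₅^{3,1}·F₅^{2,2} > 0. -/

import Mathlib

/-- Pochhammer symbol (α, n) = α(α+1)⋯(α+n-1). -/
noncomputable def poch (α : ℝ) (n : ℕ) : ℝ := ∏ i ∈ Finset.range n, (α + i)

/-- F̃(α,β) = (Γ(α)Γ(β)/Γ(α+β+1)) · Σ_{m,n≥0} (α,m)(β,n)/(α+β+1, m+n). -/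
noncomputable def Ftilde (α β : ℝ) : ℝ :=
  (Real.Gamma α * Real.Gamma β / Real.Gamma (α + β + 1)) *
    ∑' p : ℕ × ℕ, poch α p.1 * poch β p.2 / poch (α + β + 1) (p.1 + p.2)

/-- F₅^{a,b} = F̃(a/5, b/5) − F̃((5−a)/5, (5−b)/5). -/
noncomputable def F5 (a b : ℝ) : ℝ := Ftilde (a / 5) (b / 5) - Ftilde ((5 - a) / 5) ((5 - b) / 5)

theorem poch_succ (α : ℝ) (n : ℕ) : poch α (n + 1) = poch α n * (α + n) :=
  Finset.prod_range_succ _ _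

theorem poch_pos {α : ℝ} (hα : 0 < α) (n : ℕ) : 0 < poch α n :=
  Finset.prod_pos fun i _ => by positivity

theorem poch_add (α : ℝ) (m n : ℕ) : poch α (m + n) = poch α m * poch (α + m) n := by
  simp only [poch, Finset.prod_range_add, Nat.cast_add, add_assoc]

theorem mul_poch_add_one (α : ℝ) (n : ℕ) : α * poch (α + 1) n = poch α n * (α + n) := by
  rw [← poch_succ, add_comm n 1, poch_add]
  simp [poch]

theorem Gamma_add_natCast {α : ℝ} (hα : 0 < α) (n : ℕ) :
    Real.Gamma (α + n) = Real.Gamma α * poch α n := by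
  induction n with
  | zero => simp [poch]
  | succ n ih =>
    rw [poch_succ, ← mul_assoc, ← ih, Nat.cast_succ, ← add_assoc,
      Real.Gamma_add_one (by positivity), mul_comm]

theorem sum_range_poch_div_le {β δ : ℝ} (hβ : 0 < β) (hδ : 0 < δ) (n : ℕ) :
    ∑ i ∈ Finset.range n, poch β i / poch (β + δ + 1) i ≤ (β + δ) / δ := by
  have telescope : ∑ i ∈ Finset.range n, poch β i / poch (β + δ + 1) i =
      (β + δ) / δ * (1 - poch β n / poch (β + δ) n) := by
    induction n with
    | zero => simp [poch]
    | succ n ih =>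
      have h := mul_poch_add_one (β + δ) n
      have hγ : β + δ ≠ 0 := by positivity
      have hγn : β + δ + n ≠ 0 := by positivity
      have hp := (poch_pos (add_pos hβ hδ) n).ne'
      rw [Finset.sum_range_succ, ih, poch_succ, poch_succ,
        show poch (β + δ + 1) n = poch (β + δ) n * (β + δ + n) / (β + δ) by
          rw [← h]; field_simp]
      field_simp
      ring
  rw [telescope]
  have := div_pos (poch_pos hβ n) (poch_pos (add_pos hβ hδ) n)
  exact mul_le_of_le_one_right (by positivity) (by linarith)

theorem summable_poch_div {β δ : ℝ} (hβ : 0 < β) (hδ : 0 < δ) :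
    Summable fun n : ℕ => poch β n / poch (β + δ + 1) n :=
  summable_of_sum_range_le
    (fun n => (div_pos (poch_pos hβ n) (poch_pos (by positivity) n)).le)
    (sum_range_poch_div_le hβ hδ)

theorem tsum_poch_div_le {β δ : ℝ} (hβ : 0 < β) (hδ : 0 < δ) :
    ∑' n : ℕ, poch β n / poch (β + δ + 1) n ≤ (β + δ) / δ :=
  Real.tsum_le_of_sum_range_le
    (fun n => (div_pos (poch_pos hβ n) (poch_pos (by positivity) n)).le)
    (sum_range_poch_div_le hβ hδ)

theorem summable_poch_mul_poch_div {α β : ℝ} (hα : 0 < α) (hβ : 0 < β) :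
    Summable fun p : ℕ × ℕ => poch α p.1 * poch β p.2 / poch (α + β + 1) (p.1 + p.2) := by
  have split (m n : ℕ) : poch α m * poch β n / poch (α + β + 1) (m + n) =
      poch α m / poch (α + β + 1) m * (poch β n / poch (β + (α + m) + 1) n) := by
    rw [poch_add, mul_div_mul_comm]
    ring_nf
  have coeff_pos (m : ℕ) : 0 < poch α m / poch (α + β + 1) m :=
    div_pos (poch_pos hα m) (poch_pos (by positivity) m)
  rw [summable_prod_of_nonneg fun p =>
    (div_pos (mul_pos (poch_pos hα _) (poch_pos hβ _)) (poch_pos (by positivity) _)).le]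
  simp only [split, tsum_mul_left]
  refine ⟨fun m => (summable_poch_div hβ (by positivity)).mul_left _, ?_⟩
  refine Summable.of_nonneg_of_le (fun m => ?_) (fun m => ?_)
    ((summable_poch_div hα hβ).mul_right ((β + α) / α))
  · exact mul_nonneg (coeff_pos m).le (tsum_nonneg fun n =>
      (div_pos (poch_pos hβ n) (poch_pos (by positivity) n)).le)
  · refine mul_le_mul_of_nonneg_left ((tsum_poch_div_le hβ (by positivity)).trans ?_)
      (coeff_pos m).le
    rw [div_le_div_iff₀ (by positivity) hα]
    nlinarith [mul_nonneg hβ.le (Nat.cast_nonneg (α := ℝ) m)]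

theorem Gamma_mul_Gamma_add_le {a a' b : ℝ} (ha : 0 < a) (h : a < a') (hb : 0 < b) :
    Real.Gamma a' * Real.Gamma (a + b) ≤ Real.Gamma a * Real.Gamma (a' + b) := by
  have ha' : 0 < a' := ha.trans h
  have hd : 0 < a' - a + b := by linarith
  have hs : b / (a' - a + b) + (a' - a) / (a' - a + b) = 1 := by field_simp; ring
  have hs0 : 0 ≤ b / (a' - a + b) := by positivity
  have ht0 : 0 ≤ (a' - a) / (a' - a + b) := div_nonneg (by linarith) hd.le
  have hx : a ∈ Set.Ioi (0 : ℝ) := ha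
  have hy : a' + b ∈ Set.Ioi (0 : ℝ) := add_pos ha' hb
  have h1 := Real.convexOn_log_Gamma.2 hx hy hs0 ht0 hs
  have h2 := Real.convexOn_log_Gamma.2 hx hy ht0 hs0 (by rw [add_comm, hs])
  have e1 : (b / (a' - a + b)) • a + ((a' - a) / (a' - a + b)) • (a' + b) = a' := by
    simp only [smul_eq_mul]; field_simp; ring
  have e2 : ((a' - a) / (a' - a + b)) • a + (b / (a' - a + b)) • (a' + b) = a + b := by
    simp only [smul_eq_mul]; field_simp; ring
  rw [e1] at h1
  rw [e2] at h2
  simp only [smul_eq_mul, Function.comp_apply] at h1 h2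
  have g1 := Real.Gamma_pos_of_pos ha
  have g2 := Real.Gamma_pos_of_pos ha'
  have g3 := Real.Gamma_pos_of_pos (add_pos ha hb)
  have g4 := Real.Gamma_pos_of_pos (add_pos ha' hb)
  rw [← Real.log_le_log_iff (by positivity) (by positivity), Real.log_mul g2.ne' g3.ne',
    Real.log_mul g1.ne' g4.ne']
  rw [eq_sub_of_add_eq' hs] at h1 h2
  linarith

theorem Gamma_mul_Gamma_div_lt {a a' b : ℝ} (ha : 0 < a) (h : a < a') (hb : 0 < b) :
    Real.Gamma a' * Real.Gamma b / Real.Gamma (a' + b + 1) <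
      Real.Gamma a * Real.Gamma b / Real.Gamma (a + b + 1) := by
  have ha' : 0 < a' := ha.trans h
  have g1 := Real.Gamma_pos_of_pos ha
  have g2 := Real.Gamma_pos_of_pos hb
  have g3 := Real.Gamma_pos_of_pos (add_pos ha hb)
  have g4 := Real.Gamma_pos_of_pos (add_pos ha' hb)
  rw [Real.Gamma_add_one (by positivity), Real.Gamma_add_one (by positivity),
    div_lt_div_iff₀ (by positivity) (by positivity)]
  calc Real.Gamma a' * Real.Gamma b * ((a + b) * Real.Gamma (a + b))
      = (a + b) * (Real.Gamma b * (Real.Gamma a' * Real.Gamma (a + b))) := by ring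
    _ ≤ (a + b) * (Real.Gamma b * (Real.Gamma a * Real.Gamma (a' + b))) := by
        gcongr (a + b) * (Real.Gamma b * ?_)
        exact Gamma_mul_Gamma_add_le ha h hb
    _ < (a' + b) * (Real.Gamma b * (Real.Gamma a * Real.Gamma (a' + b))) := by gcongr
    _ = _ := by ring

theorem Gamma_mul_poch_mul_poch_div {α β : ℝ} (hα : 0 < α) (hβ : 0 < β) (p : ℕ × ℕ) :
    Real.Gamma α * Real.Gamma β / Real.Gamma (α + β + 1) *
        (poch α p.1 * poch β p.2 / poch (α + β + 1) (p.1 + p.2)) =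
      Real.Gamma (α + p.1) * Real.Gamma (β + p.2) /
        Real.Gamma ((α + p.1) + (β + p.2) + 1) := by
  rw [show α + p.1 + (β + p.2) + 1 = α + β + 1 + ((p.1 + p.2 : ℕ) : ℝ) by push_cast; ring,
    Gamma_add_natCast hα, Gamma_add_natCast hβ, Gamma_add_natCast (by positivity)]
  rw [div_mul_div_comm]
  ring

theorem Ftilde_lt_of_lt_left {a a' b : ℝ} (ha : 0 < a) (h : a < a') (hb : 0 < b) :
    Ftilde a' b < Ftilde a b := by
  have ha' : 0 < a' := ha.trans h
  have key (p : ℕ × ℕ) := Gamma_mul_Gamma_div_lt (a := a + p.1) (a' := a' + p.1)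
    (b := b + p.2) (by positivity) (by linarith) (by positivity)
  simp only [← Gamma_mul_poch_mul_poch_div ha hb, ← Gamma_mul_poch_mul_poch_div ha' hb] at key
  rw [Ftilde, Ftilde, ← tsum_mul_left, ← tsum_mul_left]
  exact Summable.tsum_lt_tsum (i := 0) (fun p => (key p).le) (key 0)
    ((summable_poch_mul_poch_div ha' hb).mul_left _)
    ((summable_poch_mul_poch_div ha hb).mul_left _)

theorem Ftilde_comm (a b : ℝ) : Ftilde a b = Ftilde b a := by
  rw [Ftilde, Ftilde, ← (Equiv.prodComm ℕ ℕ).tsum_eq, add_comm a b,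
    mul_comm (Real.Gamma a)]
  congr 1
  refine tsum_congr fun p => ?_
  rw [Equiv.prodComm_apply, Prod.fst_swap, Prod.snd_swap, mul_comm (poch a p.2),
    add_comm p.2]

theorem Ftilde_lt {a a' b b' : ℝ} (ha : 0 < a) (hb : 0 < b) (haa' : a < a') (hbb' : b < b') :
    Ftilde a' b' < Ftilde a b :=
  (Ftilde_lt_of_lt_left ha haa' (hb.trans hbb')).trans <| by
    rw [Ftilde_comm a, Ftilde_comm a]
    exact Ftilde_lt_of_lt_left hb hbb' ha

theorem stmt18 :
    0 < (Real.sin (4 * Real.pi / 5) / Real.sin (2 * Real.pi / 5)) * F5 1 1 * F5 1 2 +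
        (Real.sin (2 * Real.pi / 5) / Real.sin (4 * Real.pi / 5)) * F5 3 1 * F5 2 2 := by
  have h11 : 0 < F5 1 1 := sub_pos.2 (Ftilde_lt (by norm_num) (by norm_num) (by norm_num)
    (by norm_num))
  have h12 : 0 < F5 1 2 := sub_pos.2 (Ftilde_lt (by norm_num) (by norm_num) (by norm_num)
    (by norm_num))
  have h22 : 0 < F5 2 2 := sub_pos.2 (Ftilde_lt (by norm_num) (by norm_num) (by norm_num)
    (by norm_num))
  have h31 : 0 < F5 3 1 := by
    rw [F5, sub_pos, Ftilde_comm (3 / 5)]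
    exact Ftilde_lt (by norm_num) (by norm_num) (by norm_num) (by norm_num)
  have s4 : 0 < Real.sin (4 * Real.pi / 5) :=
    Real.sin_pos_of_pos_of_lt_pi (by positivity) (by linarith [Real.pi_pos])
  have s2 : 0 < Real.sin (2 * Real.pi / 5) :=
    Real.sin_pos_of_pos_of_lt_pi (by positivity) (by linarith [Real.pi_pos])
  positivity
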